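/- Let I be a homogeneous ideal of R = Z[x_1,…,x_l] and let p be a prime number that is a non-zero divisor on R/I. Then for every i ≥ 0, the i-th Betti number of (R/I) ⊗_Z Q over Q[x_1,…,x_l] is less than or equal to the i-th Betti number of (R/I) ⊗_Z F_p over F_p[x_1,…,x_l]; consequently, the projective dimension of (R/I) ⊗_Z Q as a Q[x_1,…,x_l]-module is at most the projective dimension of (R/I) ⊗_Z F_p as an F_p[x_1,…,x_l]-module. -/

import Mathlib

open CategoryTheory

namespace HApaper

/-- The `i`-th Betti number of a module `M` over `k[x_1,…,x_l]`:
`β_i(M) = dim_k Tor_i(M, k)`, where `k` carries the `k[x_1,…,x_l]`-module structure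
given by the residue field at the maximal ideal `(x_1, …, x_l)` (evaluation at `0`). -/
noncomputable def betti (k : Type) [Field k] (l : ℕ)
    (M : ModuleCat (MvPolynomial (Fin l) k)) (i : ℕ) : ℕ :=
  letI : Module (MvPolynomial (Fin l) k) k :=
    Module.compHom k (MvPolynomial.eval (0 : Fin l → k))
  let T := ((Tor (ModuleCat (MvPolynomial (Fin l) k)) i).obj M).obj
    (ModuleCat.of (MvPolynomial (Fin l) k) k)
  letI : Module k T :=
    Module.compHom T (MvPolynomial.C : k →+* MvPolynomial (Fin l) k)
  Module.finrank k T

/-- The projective dimension of a module: the least `n` such that there is a projective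
resolution vanishing in degrees `> n` (and `⊤` if there is no finite one). -/
noncomputable def projDim {A : Type} [Ring A] (M : ModuleCat A) : ℕ∞ :=
  sInf {d : ℕ∞ | ∃ n : ℕ, d = (n : ℕ∞) ∧ ∃ P : ProjectiveResolution M,
    ∀ i : ℕ, n < i → Limits.IsZero (P.complex.X i)}

section Categorical

variable {A : Type} [CommRing A]

/-- A chain complex of projectives with an augmentation, exact in positive degrees, is a
projective resolution of the cokernel. -/
theorem exists_projectiveResolution (K : ChainComplex (ModuleCat.{0} A) ℕ)
    (hproj : ∀ i, Projective (K.X i)) {L : ModuleCat.{0} A} (ε : K.X 0 ⟶ L)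
    (hε : Function.Surjective ε.hom) (h0 : Function.Exact (K.d 1 0).hom ε.hom)
    (hex : ∀ i, Function.Exact (K.d (i + 2) (i + 1)).hom (K.d (i + 1) i).hom) :
    ∃ P : ProjectiveResolution L, P.complex = K := by
  have w : K.d 1 0 ≫ ε = 0 := by
    ext x
    exact h0.apply_apply_eq_zero x
  let π : K ⟶ (ChainComplex.single₀ _).obj L := (ChainComplex.toSingle₀Equiv _ _).symm ⟨ε, w⟩
  have hπ : QuasiIso π := by
    refine ⟨fun n => ?_⟩
    cases n with
    | zero =>
      rw [ChainComplex.quasiIsoAt₀_iff, ShortComplex.quasiIso_iff_of_zeros']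
      · refine (ShortComplex.exact_and_epi_g_iff_of_iso
          (S₂ := ShortComplex.mk (K.d 1 0) ε w) ?_).2 ⟨?_, ?_⟩
        · exact ShortComplex.isoMk (Iso.refl _) (Iso.refl _) (Iso.refl _)
            ((Category.id_comp _).trans (Category.comp_id _).symm)
            ((Category.id_comp _).trans ((Category.comp_id _).trans
              (ChainComplex.toSingle₀Equiv_symm_apply_f_zero ε w)).symm)
        · exact (ShortComplex.ShortExact.moduleCat_exact_iff_function_exact _).2 h0
        · exact (ModuleCat.epi_iff_surjective _).2 hε
      · exact K.shape 0 0 (by simp)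
      all_goals rfl
    | succ n =>
      rw [quasiIsoAt_iff_exactAt']
      · rw [HomologicalComplex.exactAt_iff' _ (n + 1 + 1) (n + 1) n (by simp) (by simp)]
        exact (ShortComplex.ShortExact.moduleCat_exact_iff_function_exact _).2 (hex n)
      · apply ChainComplex.exactAt_succ_single_obj
  exact ⟨{ complex := K, projective := hproj, π := π, quasiIso := hπ }, rfl⟩

/-- Homology of a short complex of modules, in coordinates on the middle term. -/
theorem nonempty_homology_linearEquiv (S : ShortComplex (ModuleCat.{0} A)) {V : Type}
    [AddCommGroup V] [Module A V] (e : S.X₂ ≃ₗ[A] V) (Z B : Submodule A V)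
    (hZ : ∀ x, S.g.hom x = 0 ↔ e x ∈ Z) (hB : ∀ x, (∃ y, S.f.hom y = x) ↔ e x ∈ B) :
    Nonempty (S.homology ≃ₗ[A] (Z ⧸ B.submoduleOf Z)) := by
  have hZ' : (LinearMap.ker S.g.hom).map (e : S.X₂ →ₗ[A] V) = Z := by
    ext v
    constructor
    · rintro ⟨x, hx, rfl⟩
      exact (hZ x).1 hx
    · intro hv
      exact ⟨e.symm v, (hZ _).2 (by simpa using hv), by simp⟩
  let eZ : LinearMap.ker S.g.hom ≃ₗ[A] Z := e.ofSubmodules _ _ hZ'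
  refine ⟨S.moduleCatHomologyIso.toLinearEquiv ≪≫ₗ Submodule.Quotient.equiv _ _ eZ ?_⟩
  ext ⟨v, hv⟩
  change _ ↔ v ∈ B
  constructor
  · rintro ⟨x, ⟨y, rfl⟩, hx⟩
    have := (hB _).1 ⟨y, rfl⟩
    rwa [show v = e (S.f.hom y) from congrArg Subtype.val hx.symm]
  · intro hvB
    obtain ⟨y, hy⟩ := (hB (e.symm v)).2 (by simpa using hvB)
    refine ⟨S.moduleCatToCycles y, ⟨y, rfl⟩, ?_⟩
    ext
    change e (S.f.hom y) = v
    rw [hy]; simp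

theorem exists_augmentation {L : ModuleCat.{0} A} (P : ProjectiveResolution L) :
    ∃ ε : P.complex.X 0 ⟶ L, P.complex.d 1 0 ≫ ε = 0 ∧ Function.Surjective ε.hom ∧
      Function.Exact (P.complex.d 1 0).hom ε.hom :=
  ⟨P.π.f 0, P.complex_d_comp_π_f_zero,
    (ModuleCat.epi_iff_surjective _).1 (inferInstanceAs (Epi (P.π.f 0))),
    (ShortComplex.ShortExact.moduleCat_exact_iff_function_exact
      (ShortComplex.mk _ _ P.complex_d_comp_π_f_zero)).1
      (ShortComplex.exact_of_g_is_cokernel _ P.isColimitCokernelCofork)⟩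

theorem exact_d_d {L : ModuleCat.{0} A} (P : ProjectiveResolution L) (i : ℕ) :
    Function.Exact (P.complex.d (i + 2) (i + 1)).hom (P.complex.d (i + 1) i).hom :=
  (ShortComplex.ShortExact.moduleCat_exact_iff_function_exact _).1 (P.exact_succ i)

/-- A resolution of a kernel extends to a resolution of the cokernel, one step longer. -/
theorem exists_projectiveResolution_of_shortExact {N F K : Type} [AddCommGroup N] [Module A N]
    [AddCommGroup F] [Module A F] [AddCommGroup K] [Module A K] [Module.Projective A F]
    (f : N →ₗ[A] F) (g : F →ₗ[A] K) (hf : Function.Injective f) (hg : Function.Surjective g)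
    (hfg : Function.Exact f g) (n : ℕ)
    (hN : ∃ P : ProjectiveResolution (ModuleCat.of A N),
      ∀ i, n < i → Limits.IsZero (P.complex.X i)) :
    ∃ P : ProjectiveResolution (ModuleCat.of A K),
      ∀ i, n + 1 < i → Limits.IsZero (P.complex.X i) := by
  obtain ⟨P, hP⟩ := hN
  obtain ⟨π₀, hπ₀, hsurj, hex0⟩ := exists_augmentation P
  let φ : P.complex.X 0 ⟶ ModuleCat.of A F := π₀ ≫ ModuleCat.ofHom f
  have w : P.complex.d 1 0 ≫ φ = 0 := by
    rw [← Category.assoc, hπ₀, Limits.zero_comp]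
  obtain ⟨Q, hQ⟩ := exists_projectiveResolution (P.complex.augment φ w) (fun i => by
      cases i with
      | zero => exact inferInstanceAs (Projective (ModuleCat.of A F))
      | succ i => exact P.projective i) (L := ModuleCat.of A K) (ModuleCat.ofHom g) hg
      (by
        intro x
        refine Iff.trans (hfg x) ?_
        constructor
        · rintro ⟨y, rfl⟩
          obtain ⟨z, rfl⟩ := hsurj y
          exact ⟨z, rfl⟩
        · rintro ⟨z, rfl⟩
          exact ⟨π₀.hom z, rfl⟩)
      (fun i => by
        cases i with
        | zero =>
          intro x
          refine Iff.trans ?_ (hex0 x)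
          change f (π₀.hom x) = 0 ↔ _
          exact map_eq_zero_iff f hf
        | succ i =>
          exact exact_d_d P i)
  refine ⟨Q, fun i hi => ?_⟩
  rw [hQ]
  cases i with
  | zero => omega
  | succ i => exact hP i (by omega)

end Categorical

section MatrixAction

variable {A : Type} [CommRing A] {m n o : Type} [Fintype n] [Fintype o]
  {M M' : Type} [AddCommGroup M] [Module A M] [AddCommGroup M']

/-- A matrix over `A` acting on column vectors with entries in an `A`-module. -/
def matAct (D : Matrix m n A) (M : Type) [AddCommGroup M] [Module A M] :
    (n → M) →ₗ[A] (m → M) where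
  toFun v r := ∑ c, D r c • v c
  map_add' v w := by
    ext r
    simp [Finset.sum_add_distrib]
  map_smul' a v := by
    ext r
    simp [Finset.smul_sum, smul_comm a]

theorem matAct_apply (D : Matrix m n A) (v : n → M) (r : m) :
    matAct D M v r = ∑ c, D r c • v c := rfl

theorem matAct_mul (D : Matrix m n A) (E : Matrix n o A) (v : o → M) :
    matAct (D * E) M v = matAct D M (matAct E M v) := by
  ext r
  simp only [matAct_apply, Matrix.mul_apply, Finset.sum_smul, Finset.smul_sum, mul_smul]
  exact Finset.sum_comm

theorem matAct_comp [Module A M'] (D : Matrix m n A) (f : M →ₗ[A] M') (v : n → M) :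
    matAct D M' (f ∘ v) = f ∘ matAct D M v := by
  ext r
  simp [matAct_apply]

theorem matAct_map {A' : Type} [CommRing A'] [Module A' M'] (φ : A →+* A') (D : Matrix m n A)
    (f : M →+ M') (hf : ∀ a x, f (a • x) = φ a • f x) (v : n → M) :
    matAct (D.map φ) M' (f ∘ v) = f ∘ matAct D M v := by
  ext r
  simp [matAct_apply, hf]

end MatrixAction

/-- Matrices `D i` of sizes `b i × b (i + 1)` over `A` forming (after dropping the trivial `D 0`)
a free resolution of `A ⧸ m`. -/
structure MatrixResolution (A : Type) [CommRing A] (m : Ideal A) where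
  b : ℕ → ℕ
  D : ∀ i, Matrix (Fin (b i)) (Fin (b (i + 1))) A
  b_zero : b 0 = 0
  b_one : b 1 = 1
  D_mul : ∀ i, D i * D (i + 1) = 0
  exact' : ∀ i v, matAct (D (i + 1)) A v = 0 → ∃ w, matAct (D (i + 2)) A w = v
  span_row : ∀ r, Ideal.span (Set.range (D 1 r)) = m

namespace MatrixResolution

variable {A : Type} [CommRing A] {m : Ideal A} (ρ : MatrixResolution A m)

/-- Cycles of `M ⊗ P`, where `P` is the resolution. -/
abbrev cyc (M : Type) [AddCommGroup M] [Module A M] (i : ℕ) :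
    Submodule A (Fin (ρ.b (i + 1)) → M) :=
  LinearMap.ker (matAct (ρ.D i) M)

/-- Boundaries of `M ⊗ P`, where `P` is the resolution. -/
abbrev bdry (M : Type) [AddCommGroup M] [Module A M] (i : ℕ) :
    Submodule A (Fin (ρ.b (i + 1)) → M) :=
  LinearMap.range (matAct (ρ.D (i + 1)) M)

/-- Homology of `M ⊗ P`, where `P` is the resolution. -/
abbrev Hom (M : Type) [AddCommGroup M] [Module A M] (i : ℕ) : Type :=
  ρ.cyc M i ⧸ (ρ.bdry M i).submoduleOf (ρ.cyc M i)

theorem bdry_le_cyc (M : Type) [AddCommGroup M] [Module A M] (i : ℕ) :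
    ρ.bdry M i ≤ ρ.cyc M i := by
  rintro _ ⟨v, rfl⟩
  rw [LinearMap.mem_ker, ← matAct_mul, ρ.D_mul]
  ext r
  simp [matAct_apply]

theorem mem_cyc_zero {M : Type} [AddCommGroup M] [Module A M] (v : Fin (ρ.b 1) → M) :
    v ∈ ρ.cyc M 0 := by
  rw [LinearMap.mem_ker]
  ext r
  exact (Fin.cast ρ.b_zero r).elim0

/-- The index of the single generator in degree zero. -/
def pt : Fin (ρ.b 1) := Fin.cast ρ.b_one.symm 0

theorem eq_pt (r : Fin (ρ.b 1)) : r = ρ.pt :=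
  Fin.ext (by have := r.2; have := ρ.b_one; simp [pt]; omega)

/-- The boundaries in degree zero are `m • M`. -/
theorem mem_bdry_zero_iff {M : Type} [AddCommGroup M] [Module A M] (v : Fin (ρ.b 1) → M) :
    v ∈ ρ.bdry M 0 ↔ v ρ.pt ∈ m • (⊤ : Submodule A M) := by
  constructor
  · rintro ⟨w, rfl⟩
    rw [matAct_apply]
    refine Submodule.sum_mem _ fun c _ => Submodule.smul_mem_smul ?_ trivial
    exact (ρ.span_row ρ.pt).le (Ideal.subset_span ⟨c, rfl⟩)
  · intro h
    have key : ∀ x ∈ m • (⊤ : Submodule A M), (fun _ => x) ∈ ρ.bdry M 0 := by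
      intro x hx
      refine Submodule.smul_induction_on hx (fun a ha y _ => ?_)
        fun x y hx hy => Submodule.add_mem _ hx hy
      · obtain ⟨c, rfl⟩ := Ideal.mem_span_range_iff_exists_fun.1 ((ρ.span_row ρ.pt).ge ha)
        refine ⟨fun j => c j • y, ?_⟩
        ext r
        rw [matAct_apply, ρ.eq_pt r, Finset.sum_smul]
        exact Finset.sum_congr rfl fun j _ => by rw [smul_smul, mul_comm]
    convert key _ h using 2 with r
    rw [ρ.eq_pt r]

theorem nonempty_tor_linearEquiv (L : ModuleCat.{0} A) (ε : A →ₗ[A] L)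
    (hε : Function.Surjective ε) (hker : LinearMap.ker ε = m) (M : ModuleCat.{0} A) (i : ℕ) :
    Nonempty (((Tor (ModuleCat.{0} A) i).obj M).obj L ≃ₗ[A] ρ.Hom M i) := by
  let K : ChainComplex (ModuleCat.{0} A) ℕ :=
    ChainComplex.of (fun i => ModuleCat.of A (Fin (ρ.b (i + 1)) → A))
      (fun i => ModuleCat.ofHom (matAct (ρ.D (i + 1)) A))
      (fun i => by
        ext1
        apply LinearMap.ext
        intro v
        exact ρ.bdry_le_cyc A (i + 1) ⟨v, rfl⟩)
  have hKd : ∀ i, K.d (i + 1) i = ModuleCat.ofHom (matAct (ρ.D (i + 1)) A) :=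
    fun i => ChainComplex.of_d (fun i => ModuleCat.of A (Fin (ρ.b (i + 1)) → A))
      (fun i => ModuleCat.ofHom (matAct (ρ.D (i + 1)) A)) i
  let ev : K.X 0 ⟶ L := ModuleCat.ofHom (ε ∘ₗ LinearMap.proj ρ.pt)
  obtain ⟨P, hP⟩ := exists_projectiveResolution K
    (fun i => inferInstanceAs (Projective (ModuleCat.of A (Fin (ρ.b (i + 1)) → A)))) ev
    (fun x => by
      obtain ⟨a, rfl⟩ := hε x
      exact ⟨fun _ => a, rfl⟩)
    (by
      rw [hKd]
      intro v
      have htop : v ρ.pt ∈ m ↔ v ρ.pt ∈ m • (⊤ : Submodule A A) := by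
        simp only [smul_eq_mul, Ideal.mul_top]
      exact (Iff.of_eq (congrArg (v ρ.pt ∈ ·) hker)).trans
        (htop.trans (ρ.mem_bdry_zero_iff (M := A) v).symm))
    (fun i => by
      rw [hKd, hKd]
      intro v
      constructor
      · exact fun h => ρ.exact' i v h
      · rintro ⟨w, rfl⟩
        exact ρ.bdry_le_cyc A (i + 1) ⟨w, rfl⟩)
  let F := (MonoidalCategory.tensoringLeft (ModuleCat.{0} A)).obj M
  let T := (F.mapHomologicalComplex (ComplexShape.down ℕ)).obj K
  obtain ⟨e₁⟩ : Nonempty (((Tor (ModuleCat.{0} A) i).obj M).obj L ≅ T.homology i) := by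
    change Nonempty (_ ≅ ((F.mapHomologicalComplex (ComplexShape.down ℕ)).obj K).homology i)
    rw [← hP]
    exact ⟨P.isoLeftDerivedObj F i⟩
  let e (j : ℕ) : TensorProduct A M (Fin (ρ.b (j + 1)) → A) ≃ₗ[A] (Fin (ρ.b (j + 1)) → M) :=
    TensorProduct.piScalarRight A A M _
  have he : ∀ j (x : TensorProduct A M (Fin (ρ.b (j + 2)) → A)),
      e j ((matAct (ρ.D (j + 1)) A).lTensor M x) = matAct (ρ.D (j + 1)) M (e (j + 1) x) := by
    intro j x
    induction x using TensorProduct.induction_on with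
    | zero => simp
    | add x y hx hy => rw [map_add, map_add, hx, hy, map_add, map_add]
    | tmul x v =>
      ext r
      simp [e, matAct_apply, Finset.sum_smul, smul_smul]
  have hTd : ∀ j (x : T.X (j + 1)),
      (T.d (j + 1) j).hom x = (matAct (ρ.D (j + 1)) A).lTensor M x := by
    intro j x
    change (F.map (K.d (j + 1) j)).hom x = _
    rw [hKd]
    rfl
  have hT : ∀ k, ((ComplexShape.down ℕ).next i = k) →
      (∀ x : T.X i, (T.d i k).hom x = 0 ↔ e i x ∈ ρ.cyc M i) →
      Nonempty (((Tor (ModuleCat.{0} A) i).obj M).obj L ≃ₗ[A] ρ.Hom M i) := by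
    intro k hk hcyc
    obtain ⟨e₂⟩ := nonempty_homology_linearEquiv (T.sc' (i + 1) i k) (e i) (ρ.cyc M i)
      (ρ.bdry M i) hcyc (fun x => by
        constructor
        · rintro ⟨y, rfl⟩
          exact ⟨e (i + 1) y, (he i y).symm.trans (congrArg (e i) (hTd i y).symm)⟩
        · rintro ⟨w, hw⟩
          refine ⟨(e (i + 1)).symm w, (hTd i _).trans ((e i).injective ?_)⟩
          rw [he, LinearEquiv.apply_symm_apply]
          exact hw)
    exact ⟨(e₁ ≪≫ ShortComplex.homologyMapIso
      (T.isoSc' (i + 1) i k (by simp) hk)).toLinearEquiv ≪≫ₗ e₂⟩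
  cases i with
  | zero =>
    refine hT 0 (by simp) fun x => ?_
    rw [T.shape 0 0 (by simp)]
    exact iff_of_true rfl (ρ.mem_cyc_zero _)
  | succ i =>
    refine hT i (by simp) fun x => ?_
    rw [hTd]
    exact ((e i).map_eq_zero_iff).symm.trans (Iff.of_eq (congrArg (· = 0) (he i x)))

end MatrixResolution

theorem exists_matrix_ker_eq_range {A : Type} [CommRing A] [IsNoetherianRing A] {a b : ℕ}
    (D : Matrix (Fin a) (Fin b) A) :
    ∃ (c : ℕ) (E : Matrix (Fin b) (Fin c) A), ∀ v, matAct D A v = 0 ↔ ∃ w, matAct E A w = v := by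
  obtain ⟨c, s, hs⟩ := Submodule.fg_iff_exists_fin_generating_family.1
    (IsNoetherian.noetherian (LinearMap.ker (matAct D A)))
  refine ⟨c, Matrix.of fun r j => s j r, fun v => ?_⟩
  rw [← LinearMap.mem_ker, ← hs, Submodule.mem_span_range_iff_exists_fun]
  refine exists_congr fun w => Eq.congr_left ?_
  ext r
  simp [matAct_apply, mul_comm]

theorem exists_row_span_eq {A : Type} [CommRing A] [IsNoetherianRing A] (m : Ideal A) :
    ∃ (c : ℕ) (E : Matrix (Fin 1) (Fin c) A), ∀ r, Ideal.span (Set.range (E r)) = m := by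
  obtain ⟨c, s, hs⟩ := Submodule.fg_iff_exists_fin_generating_family.1 (IsNoetherian.noetherian m)
  exact ⟨c, Matrix.of fun _ j => s j, fun _ => hs⟩

namespace MatrixResolution

section Existence

variable {A : Type} [CommRing A] [IsNoetherianRing A] (m : Ideal A)

/-- The successive matrices of a free resolution, with their sizes. -/
noncomputable def step : ℕ → Σ a b : ℕ, Matrix (Fin a) (Fin b) A
  | 0 => ⟨1, (exists_row_span_eq m).choose, (exists_row_span_eq m).choose_spec.choose⟩
  | i + 1 => ⟨(step i).2.1, (exists_matrix_ker_eq_range (step i).2.2).choose,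
      (exists_matrix_ker_eq_range (step i).2.2).choose_spec.choose⟩

/-- The ranks of a free resolution. -/
noncomputable def stepRank : ℕ → ℕ
  | 0 => 0
  | i + 1 => (step m i).1

/-- The differentials of a free resolution. -/
noncomputable def stepMatrix : ∀ i, Matrix (Fin (stepRank m i)) (Fin (stepRank m (i + 1))) A
  | 0 => 0
  | i + 1 => (step m i).2.2

theorem stepMatrix_exact (i : ℕ) (v : Fin (stepRank m (i + 2)) → A) :
    matAct (stepMatrix m (i + 1)) A v = 0 ↔ ∃ w, matAct (stepMatrix m (i + 2)) A w = v :=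
  (exists_matrix_ker_eq_range (step m i).2.2).choose_spec.choose_spec v

/-- Ideals of Noetherian rings have matrix resolutions. -/
noncomputable def ofNoetherian : MatrixResolution A m where
  b := stepRank m
  D := stepMatrix m
  b_zero := rfl
  b_one := rfl
  D_mul i := by
    cases i with
    | zero =>
      ext r
      exact Fin.elim0 r
    | succ i =>
      ext r c
      have h := (stepMatrix_exact m i _).2 ⟨Pi.single c 1, rfl⟩
      rw [← matAct_mul] at h
      simpa [matAct_apply, Pi.single_apply] using congrFun h r
  exact' i v h := (stepMatrix_exact m i v).1 h
  span_row := (exists_row_span_eq m).choose_spec.choose_spec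

end Existence

variable {A : Type} [CommRing A] {m : Ideal A} (ρ : MatrixResolution A m)

/-- Base change of a matrix resolution along a ring homomorphism preserving exactness. -/
abbrev map {A' : Type} [CommRing A'] {φ : A →+* A'} {m' : Ideal A'} (hm : m.map φ = m')
    (h : ∀ i v, matAct ((ρ.D (i + 1)).map φ) A' v = 0 →
      ∃ w, matAct ((ρ.D (i + 2)).map φ) A' w = v) :
    MatrixResolution A' m' where
  b := ρ.b
  D i := (ρ.D i).map φ
  b_zero := ρ.b_zero
  b_one := ρ.b_one
  D_mul i := by
    rw [← Matrix.map_mul, ρ.D_mul, Matrix.map_zero _ (map_zero φ)]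
  exact' := h
  span_row r := by
    have h := congrArg (Ideal.map φ) (ρ.span_row r)
    rw [Ideal.map_span, ← Set.range_comp, hm] at h
    exact h

theorem cyc_le_bdry_of_finsupp (σ : Type) (i : ℕ) :
    ρ.cyc (σ →₀ A) (i + 1) ≤ ρ.bdry (σ →₀ A) (i + 1) := by
  classical
  intro v hv
  have hs : ∀ s, ∃ w, matAct (ρ.D (i + 2)) A w = fun c => v c s := by
    intro s
    refine ρ.exact' i _ ?_
    have := matAct_comp (ρ.D (i + 1)) (Finsupp.lapply s : (σ →₀ A) →ₗ[A] A) v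
    rw [LinearMap.mem_ker.1 hv] at this
    exact this.trans (by ext; simp)
  choose w hw using hs
  have hsum : v = ∑ s ∈ Finset.univ.biUnion fun c => (v c).support,
      (Finsupp.lsingle s : A →ₗ[A] (σ →₀ A)) ∘ fun c => v c s := by
    ext c t
    simp only [Finset.sum_apply, Function.comp_apply, Finsupp.lsingle_apply, Finsupp.finsetSum_apply,
      Finsupp.single_apply, Finset.sum_ite_eq', Finset.mem_biUnion, Finset.mem_univ, true_and]
    split_ifs with h
    · rfl
    · by_contra hne
      exact h ⟨c, Finsupp.mem_support_iff.2 hne⟩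
  rw [hsum]
  refine Submodule.sum_mem _ fun s _ => ?_
  rw [← hw s, ← matAct_comp]
  exact ⟨_, rfl⟩

theorem cyc_le_bdry_of_projective (F : Type) [AddCommGroup F] [Module A F]
    [Module.Projective A F] (i : ℕ) : ρ.cyc F (i + 1) ≤ ρ.bdry F (i + 1) := by
  obtain ⟨s, hs⟩ := Module.projective_def'.1 ‹Module.Projective A F›
  intro v hv
  have h : s ∘ v ∈ ρ.cyc (F →₀ A) (i + 1) := by
    rw [LinearMap.mem_ker, matAct_comp, LinearMap.mem_ker.1 hv]
    ext; simp
  obtain ⟨w, hw⟩ := ρ.cyc_le_bdry_of_finsupp F i h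
  refine ⟨Finsupp.linearCombination A id ∘ w, ?_⟩
  rw [matAct_comp, hw]
  ext c
  exact LinearMap.congr_fun hs (v c)

section ShortExact

variable {N F K : Type} [AddCommGroup N] [Module A N] [AddCommGroup F] [Module A F]
  [AddCommGroup K] [Module A K] {f : N →ₗ[A] F} {g : F →ₗ[A] K}

theorem smul_mem_bdry_succ (hf : Function.Injective f) (hg : Function.Surjective g)
    (hfg : Function.Exact f g) (i : ℕ) (r : A) (hN : ∀ z ∈ ρ.cyc N i, r • z ∈ ρ.bdry N i)
    (hF : ρ.cyc F (i + 1) ≤ ρ.bdry F (i + 1)) (z) (hz : z ∈ ρ.cyc K (i + 1)) :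
    r • z ∈ ρ.bdry K (i + 1) := by
  obtain ⟨y, rfl⟩ : ∃ y, g ∘ y = z := hg.comp_left z
  rw [LinearMap.mem_ker, matAct_comp] at hz
  have : ∀ c, ∃ n, f n = matAct (ρ.D (i + 1)) F y c := fun c => (hfg _).1 (congrFun hz c)
  choose n hn using this
  replace hn : f ∘ n = matAct (ρ.D (i + 1)) F y := funext hn
  have hnc : n ∈ ρ.cyc N i := by
    rw [LinearMap.mem_ker]
    apply hf.comp_left
    change f ∘ _ = f ∘ _
    rw [← matAct_comp, hn]
    exact (ρ.bdry_le_cyc F i ⟨y, rfl⟩).trans (by ext; simp)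
  obtain ⟨t, ht⟩ := hN n hnc
  have hyt : r • y - f ∘ t ∈ ρ.cyc F (i + 1) := by
    rw [LinearMap.mem_ker, map_sub, map_smul, matAct_comp, ht, ← hn]
    ext; simp
  obtain ⟨s, hs⟩ := hF hyt
  refine ⟨g ∘ s, ?_⟩
  rw [matAct_comp, hs]
  ext c
  simp [hfg.apply_apply_eq_zero]

theorem cyc_le_bdry_succ (hf : Function.Injective f) (hg : Function.Surjective g)
    (hfg : Function.Exact f g) (i : ℕ) (hN : ρ.cyc N i ≤ ρ.bdry N i) [Module.Projective A F] :
    ρ.cyc K (i + 1) ≤ ρ.bdry K (i + 1) := fun z hz => by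
  simpa using ρ.smul_mem_bdry_succ hf hg hfg i 1 (fun z hz => by simpa using hN hz)
    (ρ.cyc_le_bdry_of_projective F i) z hz

theorem mem_bdry_of_comp_mem_bdry (hf : Function.Injective f) (hg : Function.Surjective g)
    (hfg : Function.Exact f g) (i : ℕ) (hK : ρ.cyc K (i + 1) ≤ ρ.bdry K (i + 1))
    (z : Fin (ρ.b (i + 1)) → N) (hz : f ∘ z ∈ ρ.bdry F i) : z ∈ ρ.bdry N i := by
  obtain ⟨y, hy⟩ := hz
  have hgy : g ∘ y ∈ ρ.cyc K (i + 1) := by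
    rw [LinearMap.mem_ker, matAct_comp, hy]
    ext c
    exact hfg.apply_apply_eq_zero _
  obtain ⟨w', hw⟩ := hK hgy
  obtain ⟨w, rfl⟩ : ∃ w, g ∘ w = w' := hg.comp_left w'
  have : ∀ c, ∃ n, f n = (y - matAct (ρ.D (i + 2)) F w) c := fun c => (hfg _).1 (by
    have := congrFun hw c
    rw [matAct_comp] at this
    simpa [sub_eq_zero] using this.symm)
  choose n hn using this
  refine ⟨n, hf.comp_left ?_⟩
  change f ∘ _ = f ∘ _
  rw [← matAct_comp, show f ∘ n = _ from funext hn, map_sub, hy,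
    LinearMap.mem_ker.1 (ρ.bdry_le_cyc F (i + 1) ⟨w, rfl⟩), sub_zero]

theorem cyc_le_bdry_of_succ (hf : Function.Injective f) (hg : Function.Surjective g)
    (hfg : Function.Exact f g) (i : ℕ) (hK : ρ.cyc K (i + 2) ≤ ρ.bdry K (i + 2))
    [Module.Projective A F] : ρ.cyc N (i + 1) ≤ ρ.bdry N (i + 1) := fun z hz => by
  refine ρ.mem_bdry_of_comp_mem_bdry hf hg hfg (i + 1) hK z
    (ρ.cyc_le_bdry_of_projective F i ?_)
  rw [LinearMap.mem_ker, matAct_comp, LinearMap.mem_ker.1 hz]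
  ext; simp

end ShortExact

/-- The ideal `m` annihilates the homology. -/
theorem smul_mem_bdry {r : A} (hr : r ∈ m) (i : ℕ) :
    ∀ (M : Type) [AddCommGroup M] [Module A M], ∀ z ∈ ρ.cyc M i, r • z ∈ ρ.bdry M i := by
  induction i with
  | zero =>
    intro M _ _ z _
    exact (ρ.mem_bdry_zero_iff _).2 (Submodule.smul_mem_smul hr trivial)
  | succ i ih =>
    intro M _ _ z hz
    let g : (M →₀ A) →ₗ[A] M := Finsupp.linearCombination A id
    have hf : Function.Injective (LinearMap.ker g).subtype := Subtype.val_injective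
    have hfg : Function.Exact (LinearMap.ker g).subtype g := LinearMap.exact_subtype_ker_map g
    exact ρ.smul_mem_bdry_succ (N := LinearMap.ker g) (F := M →₀ A) hf
      (Finsupp.linearCombination_id_surjective A M) hfg i r (fun z hz => ih _ z hz)
      (ρ.cyc_le_bdry_of_projective _ i) z hz

end MatrixResolution

/-- An additive map which becomes bijective after inverting the nonzero integers. -/
structure IsRationalIso {M M' : Type} [AddCommGroup M] [AddCommGroup M'] (f : M →+ M') : Prop where
  surj : ∀ y, ∃ N : ℤ, N ≠ 0 ∧ ∃ x, f x = N • y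
  inj : ∀ x, f x = 0 → ∃ N : ℤ, N ≠ 0 ∧ N • x = 0

theorem IsRationalIso.compLeft {M M' : Type} [AddCommGroup M] [AddCommGroup M'] {f : M →+ M'}
    (hf : IsRationalIso f) (ι : Type) [Fintype ι] : IsRationalIso (f.compLeft ι) := by
  classical
  constructor
  · intro y
    choose N hN x hx using fun i => hf.surj (y i)
    refine ⟨∏ i, N i, Finset.prod_ne_zero_iff.2 fun i _ => hN i,
      fun i => (∏ j ∈ Finset.univ.erase i, N j) • x i, ?_⟩
    ext i
    simp [hx, smul_smul, Finset.prod_erase_mul]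
  · intro x h
    choose N hN hx using fun i => hf.inj (x i) (congrFun h i)
    refine ⟨∏ i, N i, Finset.prod_ne_zero_iff.2 fun i _ => hN i, ?_⟩
    ext i
    simp [← Finset.prod_erase_mul Finset.univ N (Finset.mem_univ i), mul_smul, hx]

/-- Reduction modulo `p` of a group without `p`-torsion. -/
structure IsReductionMod (p : ℕ) {M M' : Type} [AddCommGroup M] [AddCommGroup M']
    (f : M →+ M') : Prop where
  surj : Function.Surjective f
  ker : ∀ x, f x = 0 ↔ ∃ y, x = p • y
  torsion : ∀ x : M, p • x = 0 → x = 0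

theorem IsReductionMod.compLeft {p : ℕ} {M M' : Type} [AddCommGroup M] [AddCommGroup M']
    {f : M →+ M'} (hf : IsReductionMod p f) (ι : Type) : IsReductionMod p (f.compLeft ι) := by
  refine ⟨hf.surj.comp_left, fun x => ?_, fun x h => ?_⟩
  · rw [funext_iff]
    refine (forall_congr' fun i => hf.ker (x i)).trans ?_
    rw [Classical.skolem]
    exact exists_congr fun y => funext_iff.symm
  · exact funext fun i => hf.torsion _ (congrFun h i)

section Semilinear

variable {A A' : Type} [CommRing A] [CommRing A'] {φ : A →+* A'} {M M' : Type} [AddCommGroup M]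
  [Module A M] [AddCommGroup M'] [Module A' M'] (f : M →ₛₗ[φ] M')

theorem matAct_map_compLeft {m n : Type} [Fintype n] (D : Matrix m n A) (v : n → M) :
    matAct (D.map φ) M' (f.toAddMonoidHom.compLeft n v) =
      f.toAddMonoidHom.compLeft m (matAct D M v) :=
  matAct_map φ D f.toAddMonoidHom (fun a x => f.map_smulₛₗ a x) v

theorem IsRationalIso.exists_lift_ker {f : M →ₛₗ[φ] M'} (hf : IsRationalIso f.toAddMonoidHom)
    {m n : Type} [Fintype m] [Fintype n] (D : Matrix m n A) (z : n → M')
    (hz : matAct (D.map φ) M' z = 0) :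
    ∃ N : ℤ, N ≠ 0 ∧ ∃ x, matAct D M x = 0 ∧ f.toAddMonoidHom.compLeft n x = N • z := by
  obtain ⟨N, hN, x, hx⟩ := (hf.compLeft n).surj z
  obtain ⟨N', hN', h⟩ := (hf.compLeft m).inj (matAct D M x) (by
    rw [← matAct_map_compLeft, hx, map_zsmul, hz, smul_zero])
  refine ⟨N' * N, mul_ne_zero hN' hN, N' • x, by rw [map_zsmul, h], ?_⟩
  rw [map_zsmul, hx, mul_smul]

namespace MatrixResolution

variable {m : Ideal A} (ρ : MatrixResolution A m)

theorem exact_map_of_isRationalIso (hφ : IsRationalIso φ.toAddMonoidHom)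
    (hunit : ∀ N : ℤ, N ≠ 0 → IsUnit (N : A')) (i : ℕ) (v : Fin (ρ.b (i + 2)) → A')
    (hv : matAct ((ρ.D (i + 1)).map φ) A' v = 0) :
    ∃ w, matAct ((ρ.D (i + 2)).map φ) A' w = v := by
  let f : A →ₛₗ[φ] A' := { φ with map_smul' := fun a x => map_mul φ a x }
  obtain ⟨N, hN, x, hx, hxv⟩ := IsRationalIso.exists_lift_ker (f := f) hφ _ v hv
  obtain ⟨w, rfl⟩ := ρ.exact' i x hx
  obtain ⟨u, hu⟩ := hunit N hN
  refine ⟨(↑u⁻¹ : A') • f.toAddMonoidHom.compLeft _ w, ?_⟩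
  rw [map_smul, matAct_map_compLeft, hxv, ← Int.cast_smul_eq_zsmul A', ← hu, smul_smul,
    Units.inv_mul, one_smul]

theorem exact_map_of_isReductionMod {p : ℕ} (hφ : IsReductionMod p φ.toAddMonoidHom)
    (hm : ∀ a, p • a ∈ m → a ∈ m) (i : ℕ) (v : Fin (ρ.b (i + 2)) → A')
    (hv : matAct ((ρ.D (i + 1)).map φ) A' v = 0) :
    ∃ w, matAct ((ρ.D (i + 2)).map φ) A' w = v := by
  let f : A →ₛₗ[φ] A' := { φ with map_smul' := fun a x => map_mul φ a x }
  have hf : IsReductionMod p f.toAddMonoidHom := hφ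
  obtain ⟨w, rfl⟩ := (hf.compLeft _).surj v
  obtain ⟨u, hu⟩ := ((hf.compLeft _).ker (matAct (ρ.D (i + 1)) A w)).1 (by
    rw [← matAct_map_compLeft, hv])
  have hub : u ∈ ρ.bdry A i := by
    cases i with
    | zero =>
      have h : p • u ∈ ρ.bdry A 0 := ⟨w, hu⟩
      rw [mem_bdry_zero_iff] at h ⊢
      simp only [smul_eq_mul, Ideal.mul_top] at h ⊢
      exact hm _ h
    | succ i =>
      refine ρ.exact' i u ((hf.compLeft _).torsion _ ?_)
      rw [← map_nsmul, ← hu]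
      exact ρ.bdry_le_cyc A (i + 1) ⟨w, rfl⟩
  obtain ⟨t, rfl⟩ := hub
  obtain ⟨s, hs⟩ := ρ.exact' i (w - p • t) (by rw [map_sub, map_nsmul, hu, sub_self])
  refine ⟨f.toAddMonoidHom.compLeft _ s, ?_⟩
  rw [matAct_map_compLeft, hs, map_sub, ((hf.compLeft _).ker (p • t)).2 ⟨t, rfl⟩, sub_zero]

variable {m' : Ideal A'} (hm : m.map φ = m') (h : ∀ i v, matAct ((ρ.D (i + 1)).map φ) A' v = 0 →
      ∃ w, matAct ((ρ.D (i + 2)).map φ) A' w = v)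

theorem compLeft_mem_cyc (i : ℕ) {z} (hz : z ∈ ρ.cyc M i) :
    f.toAddMonoidHom.compLeft _ z ∈ (ρ.map hm h).cyc M' i := by
  rw [LinearMap.mem_ker] at hz ⊢
  exact (matAct_map_compLeft f _ z).trans (by rw [hz, map_zero])

theorem compLeft_mem_bdry (i : ℕ) {z} (hz : z ∈ ρ.bdry M i) :
    f.toAddMonoidHom.compLeft _ z ∈ (ρ.map hm h).bdry M' i := by
  obtain ⟨w, rfl⟩ := hz
  exact ⟨_, matAct_map_compLeft f _ w⟩

/-- The map on cycles induced by a semilinear map. -/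
def cycMap (i : ℕ) : ρ.cyc M i →+ (ρ.map hm h).cyc M' i where
  toFun z := ⟨_, ρ.compLeft_mem_cyc f hm h i z.2⟩
  map_zero' := Subtype.ext (map_zero (f.toAddMonoidHom.compLeft _))
  map_add' x y := Subtype.ext (map_add (f.toAddMonoidHom.compLeft _) x.1 y.1)

/-- The map on homology induced by a semilinear map. -/
def homMap (i : ℕ) : ρ.Hom M i →+ (ρ.map hm h).Hom M' i :=
  QuotientAddGroup.map _ _ (ρ.cycMap f hm h i) fun _ hz => ρ.compLeft_mem_bdry f hm h i hz

theorem homMap_mk (i : ℕ) (z : ρ.cyc M i) :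
    ρ.homMap f hm h i (Submodule.Quotient.mk z) = Submodule.Quotient.mk (ρ.cycMap f hm h i z) := rfl

variable {f}

theorem homMap_surj_of_isRationalIso (hf : IsRationalIso f.toAddMonoidHom) (i : ℕ)
    (y : (ρ.map hm h).Hom M' i) : ∃ N : ℤ, N ≠ 0 ∧ ∃ x, ρ.homMap f hm h i x = N • y := by
  obtain ⟨z, rfl⟩ := Submodule.Quotient.mk_surjective _ y
  obtain ⟨N, hN, x, hx, hxz⟩ := hf.exists_lift_ker _ z.1 z.2
  refine ⟨N, hN, Submodule.Quotient.mk ⟨x, hx⟩, ?_⟩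
  rw [homMap_mk]
  refine (congrArg _ (Subtype.ext hxz : _ = N • z)).trans ?_
  exact map_zsmul (Submodule.mkQ _) N z

theorem homMap_ker_of_isReductionMod {p : ℕ} (hf : IsReductionMod p f.toAddMonoidHom) (i : ℕ)
    (x : ρ.Hom M i) (hx : ρ.homMap f hm h i x = 0) : ∃ y, x = p • y := by
  obtain ⟨z, rfl⟩ := Submodule.Quotient.mk_surjective _ x
  rw [homMap_mk, Submodule.Quotient.mk_eq_zero] at hx
  obtain ⟨w', hw⟩ := hx
  obtain ⟨w, rfl⟩ := (hf.compLeft _).surj w'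
  obtain ⟨u, hu⟩ := ((hf.compLeft _).ker (z.1 - matAct (ρ.D (i + 1)) M w)).1 (by
    rw [map_sub, ← matAct_map_compLeft, sub_eq_zero]
    exact hw.symm)
  have huc : u ∈ ρ.cyc M i := by
    rw [LinearMap.mem_ker]
    refine (hf.compLeft _).torsion _ ?_
    rw [← map_nsmul, ← hu, map_sub, LinearMap.mem_ker.1 z.2,
      LinearMap.mem_ker.1 (ρ.bdry_le_cyc M i ⟨w, rfl⟩), sub_zero]
  refine ⟨Submodule.Quotient.mk ⟨u, huc⟩, ?_⟩
  refine Eq.trans ?_ (map_nsmul (Submodule.mkQ _) p _)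
  refine (Submodule.Quotient.eq _).2 ⟨w, ?_⟩
  have : z.1 - p • u = matAct (ρ.D (i + 1)) M w := by rw [← hu, sub_sub_cancel]
  exact this.symm

end MatrixResolution

end Semilinear

theorem finite_and_finrank_le_of_fg {H V W : Type} [AddCommGroup H] [Module.Finite ℤ H]
    [AddCommGroup V] [Module ℚ V] (p : ℕ) [Fact p.Prime] [AddCommGroup W] [Module (ZMod p) W]
    [Module.Finite (ZMod p) W] (a : H →+ V) (b : H →+ W)
    (ha : ∀ y, ∃ N : ℤ, N ≠ 0 ∧ ∃ x, a x = N • y) (hb : ∀ x, b x = 0 → ∃ y, x = p • y) :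
    Module.Finite ℚ V ∧ Module.finrank ℚ V ≤ Module.finrank (ZMod p) W := by
  let T := Submodule.torsion ℤ H
  let e := Module.finBasis ℤ (H ⧸ T)
  choose h hh using fun j => T.mkQ_surjective (e j)
  have hspan : ⊤ ≤ Submodule.span ℚ (Set.range (a ∘ h)) := by
    intro y _
    obtain ⟨N, hN, x, hx⟩ := ha y
    have hxT : x - ∑ j, e.repr (T.mkQ x) j • h j ∈ T := by
      refine (Submodule.Quotient.mk_eq_zero T).1 ?_
      change T.mkQ _ = 0
      rw [map_sub, map_sum]
      simp only [map_smul, hh]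
      rw [e.sum_repr, sub_self]
    obtain ⟨⟨k, hk⟩, hk'⟩ := (Submodule.mem_torsion_iff _).1 hxT
    have hk0 : k ≠ 0 := nonZeroDivisors.ne_zero hk
    have hax : a x = ∑ j, e.repr (T.mkQ x) j • a (h j) := by
      have h1 := congrArg a hk'
      change a (k • _) = _ at h1
      rw [map_zsmul, map_zero, ← Int.cast_smul_eq_zsmul ℚ, smul_eq_zero] at h1
      have h2 := h1.resolve_left (by exact_mod_cast hk0)
      rw [map_sub, sub_eq_zero, map_sum] at h2
      simpa only [map_zsmul] using h2
    have hy : y = (N : ℚ)⁻¹ • a x := by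
      rw [hx, ← Int.cast_smul_eq_zsmul ℚ, smul_smul, inv_mul_cancel₀ (by exact_mod_cast hN),
        one_smul]
    rw [hy, hax]
    refine Submodule.smul_mem _ _ (Submodule.sum_mem _ fun j _ => ?_)
    rw [← Int.cast_smul_eq_zsmul ℚ]
    exact Submodule.smul_mem _ _ (Submodule.subset_span ⟨j, rfl⟩)
  have hind : LinearIndependent (ZMod p) (b ∘ h) := by
    rw [Fintype.linearIndependent_iff]
    intro c hc j
    obtain ⟨y, hy⟩ := hb (∑ j, (c j).val • h j) (by
      rw [map_sum, ← hc]
      refine Finset.sum_congr rfl fun j _ => ?_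
      rw [map_nsmul, ← Nat.cast_smul_eq_nsmul (ZMod p), ZMod.natCast_zmod_val]
      rfl)
    have h1 := congrArg (fun x => e.repr (T.mkQ x) j) hy
    simp only [map_sum, map_nsmul, hh] at h1
    rw [← ZMod.natCast_zmod_val (c j), ZMod.natCast_eq_zero_iff, ← Int.natCast_dvd_natCast]
    refine ⟨e.repr (T.mkQ y) j, ?_⟩
    simpa [Finsupp.single_apply] using h1
  have hfin : Module.Finite ℚ V :=
    ⟨Submodule.fg_def.2 ⟨_, Set.finite_range _, top_le_iff.1 hspan⟩⟩
  refine ⟨hfin, ?_⟩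
  have h1 := finrank_range_le_card (R := ℚ) (a ∘ h)
  rw [Set.finrank, top_le_iff.1 hspan, finrank_top] at h1
  exact h1.trans hind.fintype_card_le_finrank

open MvPolynomial

theorem mem_idealOfVars_iff {σ B : Type} [CommRing B] (f : MvPolynomial σ B) :
    f ∈ idealOfVars σ B ↔ constantCoeff f = 0 := by
  rw [← pow_one (idealOfVars σ B), mem_pow_idealOfVars_iff']
  simp [Finsupp.degree_eq_zero_iff, constantCoeff_eq]

theorem map_idealOfVars {σ B B' : Type} [CommRing B] [CommRing B'] (φ : B →+* B') :
    (idealOfVars σ B).map (map φ) = idealOfVars σ B' := by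
  rw [Ideal.map_span, ← Set.range_comp]
  congr 2
  ext1 i
  exact map_X φ i

theorem finite_of_idealOfVars_smul_eq_zero {σ B Y : Type} [CommRing B] [AddCommGroup Y]
    [Module (MvPolynomial σ B) Y] [Module.Finite (MvPolynomial σ B) Y] [Module B Y]
    (hB : ∀ (c : B) (y : Y), (C c : MvPolynomial σ B) • y = c • y)
    (hY : ∀ f ∈ idealOfVars σ B, ∀ y : Y, f • y = 0) : Module.Finite B Y := by
  obtain ⟨s, hs⟩ := Module.Finite.fg_top (R := MvPolynomial σ B) (M := Y)
  refine ⟨s, top_le_iff.1 fun y _ => ?_⟩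
  have hy : y ∈ Submodule.span (MvPolynomial σ B) (s : Set Y) := hs ▸ trivial
  induction hy using Submodule.span_induction with
  | mem x h => exact Submodule.subset_span h
  | zero => exact Submodule.zero_mem _
  | add x y _ _ hx hy => exact Submodule.add_mem _ (hx trivial) (hy trivial)
  | smul f x _ hx =>
    have h := hY (f - C (constantCoeff f)) ((mem_idealOfVars_iff _).2 (by simp)) x
    rw [sub_smul, sub_eq_zero, hB] at h
    rw [h]
    exact Submodule.smul_mem _ _ (hx trivial)

namespace MatrixResolution

theorem hom_smul_eq_zero {A : Type} [CommRing A] {m : Ideal A} (ρ : MatrixResolution A m)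
    (M : Type) [AddCommGroup M] [Module A M] (i : ℕ) {r : A} (hr : r ∈ m) (x : ρ.Hom M i) :
    r • x = 0 := by
  obtain ⟨z, rfl⟩ := Submodule.Quotient.mk_surjective _ x
  rw [← Submodule.Quotient.mk_smul, Submodule.Quotient.mk_eq_zero]
  exact ρ.smul_mem_bdry hr i M z.1 z.2

theorem finite_hom {σ B : Type} [CommRing B] [IsNoetherianRing B] [Finite σ]
    (ρ : MatrixResolution (MvPolynomial σ B) (idealOfVars σ B)) (M : Type) [AddCommGroup M]
    [Module (MvPolynomial σ B) M] [Module.Finite (MvPolynomial σ B) M] (i : ℕ)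
    [Module B (ρ.Hom M i)]
    (hB : ∀ (c : B) (y : ρ.Hom M i), (C c : MvPolynomial σ B) • y = c • y) :
    Module.Finite B (ρ.Hom M i) :=
  finite_of_idealOfVars_smul_eq_zero hB fun _ hf => ρ.hom_smul_eq_zero M i hf

theorem betti_eq_finrank {k : Type} [Field k] {l : ℕ}
    (ρ : MatrixResolution (MvPolynomial (Fin l) k) (idealOfVars (Fin l) k))
    (M : ModuleCat (MvPolynomial (Fin l) k)) (i : ℕ) [Module k (ρ.Hom M i)]
    (hk : ∀ (c : k) (y : ρ.Hom M i), (C c : MvPolynomial (Fin l) k) • y = c • y) :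
    betti k l M i = Module.finrank k (ρ.Hom M i) := by
  let : Module (MvPolynomial (Fin l) k) k :=
    Module.compHom k (MvPolynomial.eval (0 : Fin l → k))
  let ε : MvPolynomial (Fin l) k →ₗ[MvPolynomial (Fin l) k] k :=
    { MvPolynomial.eval (0 : Fin l → k) with map_smul' := fun a x => map_mul (MvPolynomial.eval (0 : Fin l → k)) a x }
  obtain ⟨e⟩ := ρ.nonempty_tor_linearEquiv (ModuleCat.of (MvPolynomial (Fin l) k) k) ε
    (fun c => ⟨C c, eval_C c⟩) (by
      ext f
      rw [mem_idealOfVars_iff, LinearMap.mem_ker]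
      change eval 0 f = 0 ↔ _
      rw [eval_zero]) M i
  let := Module.compHom (((Tor (ModuleCat (MvPolynomial (Fin l) k)) i).obj M).obj
    (ModuleCat.of (MvPolynomial (Fin l) k) k)) (C : k →+* MvPolynomial (Fin l) k)
  exact LinearEquiv.finrank_eq
    { e with map_smul' := fun c x => (e.map_smul (C c) x).trans (hk c (e x)) }

end MatrixResolution

/-- The map induced on quotients by an ideal and its extension. -/
def quotientSemilinear {A A' : Type} [CommRing A] [CommRing A'] (φ : A →+* A') (I : Ideal A) :
    (A ⧸ I) →ₛₗ[φ] (A' ⧸ I.map φ) where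
  __ := Ideal.quotientMap (I.map φ) φ Ideal.le_comap_map
  map_smul' a x := by
    obtain ⟨x, rfl⟩ := Ideal.Quotient.mk_surjective x
    exact congrArg (Ideal.Quotient.mk _) (map_mul φ a x)

theorem exists_smul_eq_of_mem_map_rat {l : ℕ} (I : Ideal (MvPolynomial (Fin l) ℤ))
    (f : MvPolynomial (Fin l) ℚ) (hf : f ∈ I.map (map (Int.castRingHom ℚ))) :
    ∃ N : ℤ, N ≠ 0 ∧ ∃ g ∈ I, map (Int.castRingHom ℚ) g = N • f := by
  let : Algebra (MvPolynomial (Fin l) ℤ) (MvPolynomial (Fin l) ℚ) := algebraMvPolynomial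
  obtain ⟨⟨⟨g, hg⟩, ⟨_, N, hN, rfl⟩⟩, h⟩ := (IsLocalization.mem_map_algebraMap_iff
    ((nonZeroDivisors ℤ).map (C (σ := Fin l))) (MvPolynomial (Fin l) ℚ)).1 hf
  refine ⟨N, nonZeroDivisors.ne_zero hN, g, hg, ?_⟩
  refine h.symm.trans ?_
  rw [algebraMap_def, map_C, mul_comm, zsmul_eq_mul]
  simp

theorem isRationalIso_map_rat (l : ℕ) :
    IsRationalIso (map (σ := Fin l) (Int.castRingHom ℚ)).toAddMonoidHom := by
  constructor
  · intro f
    obtain ⟨N, hN, g, _, h⟩ := exists_smul_eq_of_mem_map_rat ⊤ f (by simp [Ideal.map_top])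
    exact ⟨N, hN, g, h⟩
  · intro f hf
    exact ⟨1, one_ne_zero, by
      rw [one_smul]
      exact map_injective _ Int.cast_injective (hf.trans (map_zero _).symm)⟩

theorem isRationalIso_quotient_rat {l : ℕ} (I : Ideal (MvPolynomial (Fin l) ℤ)) :
    IsRationalIso (quotientSemilinear (map (Int.castRingHom ℚ)) I).toAddMonoidHom := by
  constructor
  · intro y
    obtain ⟨y, rfl⟩ := Ideal.Quotient.mk_surjective y
    obtain ⟨N, hN, x, hx⟩ := (isRationalIso_map_rat l).surj y
    exact ⟨N, hN, Ideal.Quotient.mk _ x, (congrArg (Ideal.Quotient.mk _) hx).trans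
      (map_zsmul _ N y)⟩
  · intro x hx
    obtain ⟨x, rfl⟩ := Ideal.Quotient.mk_surjective x
    obtain ⟨N, hN, g, hg, h⟩ := exists_smul_eq_of_mem_map_rat I _ (Ideal.Quotient.eq_zero_iff_mem.1 hx)
    refine ⟨N, hN, ?_⟩
    rw [← map_zsmul, Ideal.Quotient.eq_zero_iff_mem]
    exact map_injective _ Int.cast_injective (h.trans (map_zsmul _ N x).symm) ▸ hg

theorem isReductionMod_map_zmod (l p : ℕ) [Fact p.Prime] :
    IsReductionMod p (map (σ := Fin l) (Int.castRingHom (ZMod p))).toAddMonoidHom := by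
  refine ⟨map_surjective _ (ZMod.ringHom_surjective _), fun f => ?_, fun f hf => ?_⟩
  · rw [show (map (Int.castRingHom (ZMod p))).toAddMonoidHom f = 0 ↔
      f ∈ RingHom.ker (map (Int.castRingHom (ZMod p))) from Iff.rfl, ker_map,
      ZMod.ker_intCastRingHom, Ideal.map_span, Set.image_singleton, Ideal.mem_span_singleton]
    simp [dvd_def]
  · rw [smul_eq_zero] at hf
    exact hf.resolve_left (Fact.out : p.Prime).ne_zero

theorem isReductionMod_quotient_zmod {l p : ℕ} [Fact p.Prime] (I : Ideal (MvPolynomial (Fin l) ℤ))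
    (hreg : ∀ f : MvPolynomial (Fin l) ℤ, (p : MvPolynomial (Fin l) ℤ) * f ∈ I → f ∈ I) :
    IsReductionMod p (quotientSemilinear (map (Int.castRingHom (ZMod p))) I).toAddMonoidHom := by
  have hφ := isReductionMod_map_zmod l p
  refine ⟨?_, ?_, ?_⟩
  · intro y
    obtain ⟨y, rfl⟩ := Ideal.Quotient.mk_surjective y
    obtain ⟨x, rfl⟩ := hφ.surj y
    exact ⟨Ideal.Quotient.mk _ x, rfl⟩
  · intro x
    obtain ⟨x, rfl⟩ := Ideal.Quotient.mk_surjective x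
    refine Ideal.Quotient.eq_zero_iff_mem.trans ⟨fun h => ?_, ?_⟩
    · obtain ⟨y, hy, h⟩ := (Ideal.mem_map_iff_of_surjective
        (map (Int.castRingHom (ZMod p))) hφ.surj).1 h
      obtain ⟨z, hz⟩ := (hφ.ker (x - y)).1 (by
        rw [map_sub, sub_eq_zero]
        exact h.symm)
      refine ⟨Ideal.Quotient.mk _ z, ?_⟩
      rw [← map_nsmul, ← hz, map_sub, Ideal.Quotient.eq_zero_iff_mem.2 hy, sub_zero]
    · rintro ⟨z, hz⟩
      obtain ⟨z, rfl⟩ := Ideal.Quotient.mk_surjective z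
      rw [← map_nsmul, Ideal.Quotient.mk_eq_mk_iff_sub_mem] at hz
      have h := Ideal.mem_map_of_mem (map (Int.castRingHom (ZMod p))) hz
      have h0 : map (Int.castRingHom (ZMod p)) (p • z) = 0 := (hφ.ker _).2 ⟨z, rfl⟩
      rwa [map_sub, h0, sub_zero] at h
  · intro x hx
    obtain ⟨x, rfl⟩ := Ideal.Quotient.mk_surjective x
    rw [← map_nsmul, Ideal.Quotient.eq_zero_iff_mem, nsmul_eq_mul] at hx
    exact Ideal.Quotient.eq_zero_iff_mem.2 (hreg x hx)

theorem exists_matrixResolution_betti_le {l : ℕ} (I : Ideal (MvPolynomial (Fin l) ℤ)) (p : ℕ)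
    [Fact p.Prime]
    (hreg : ∀ f : MvPolynomial (Fin l) ℤ, (p : MvPolynomial (Fin l) ℤ) * f ∈ I → f ∈ I) :
    ∃ (ρ : MatrixResolution (MvPolynomial (Fin l) ℚ) (idealOfVars (Fin l) ℚ))
      (ρ' : MatrixResolution (MvPolynomial (Fin l) (ZMod p)) (idealOfVars (Fin l) (ZMod p))),
      ∀ i, betti ℚ l (ModuleCat.of (MvPolynomial (Fin l) ℚ)
          (MvPolynomial (Fin l) ℚ ⧸ I.map (MvPolynomial.map (Int.castRingHom ℚ)))) i ≤
        betti (ZMod p) l (ModuleCat.of (MvPolynomial (Fin l) (ZMod p))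
          (MvPolynomial (Fin l) (ZMod p) ⧸
            I.map (MvPolynomial.map (Int.castRingHom (ZMod p))))) i ∧
      (ρ'.cyc (MvPolynomial (Fin l) (ZMod p) ⧸
          I.map (MvPolynomial.map (Int.castRingHom (ZMod p)))) i ≤ ρ'.bdry _ i →
        ρ.cyc (MvPolynomial (Fin l) ℚ ⧸ I.map (MvPolynomial.map (Int.castRingHom ℚ))) i ≤
          ρ.bdry _ i) := by
  let ρ₀ := MatrixResolution.ofNoetherian (idealOfVars (Fin l) ℤ)
  let ρ := ρ₀.map (map_idealOfVars (Int.castRingHom ℚ))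
    (ρ₀.exact_map_of_isRationalIso (isRationalIso_map_rat l) fun N hN => by
      rw [← map_intCast (C : ℚ →+* MvPolynomial (Fin l) ℚ)]
      exact (isUnit_iff_ne_zero.2 (by exact_mod_cast hN)).map C)
  let ρ' := ρ₀.map (map_idealOfVars (Int.castRingHom (ZMod p)))
    (ρ₀.exact_map_of_isReductionMod (isReductionMod_map_zmod l p) fun a ha => by
      rw [mem_idealOfVars_iff] at ha ⊢
      rw [map_nsmul, smul_eq_zero] at ha
      exact ha.resolve_left (Fact.out : p.Prime).ne_zero)
  refine ⟨ρ, ρ', fun i => ?_⟩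
  let V := ρ.Hom (MvPolynomial (Fin l) ℚ ⧸ I.map (MvPolynomial.map (Int.castRingHom ℚ))) i
  let W := ρ'.Hom (MvPolynomial (Fin l) (ZMod p) ⧸
    I.map (MvPolynomial.map (Int.castRingHom (ZMod p)))) i
  let : Module ℚ V := Module.compHom V (C : ℚ →+* MvPolynomial (Fin l) ℚ)
  let : Module (ZMod p) W := Module.compHom W (C : ZMod p →+* MvPolynomial (Fin l) (ZMod p))
  have hW : Module.Finite (ZMod p) W := ρ'.finite_hom _ i fun _ _ => rfl
  have hH : Module.Finite ℤ (ρ₀.Hom (MvPolynomial (Fin l) ℤ ⧸ I) i) :=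
    ρ₀.finite_hom _ i fun c y => by rw [← Int.cast_smul_eq_zsmul (MvPolynomial (Fin l) ℤ) c y]; simp
  obtain ⟨hV, hle⟩ := finite_and_finrank_le_of_fg (V := V) (W := W) p _ _
    (ρ₀.homMap_surj_of_isRationalIso _ _ (isRationalIso_quotient_rat I) i)
    (ρ₀.homMap_ker_of_isReductionMod _ _ (isReductionMod_quotient_zmod I hreg) i)
  refine ⟨?_, fun h => ?_⟩
  · rw [ρ.betti_eq_finrank _ i fun _ _ => rfl, ρ'.betti_eq_finrank _ i fun _ _ => rfl]
    exact hle
  · have hW0 : Subsingleton W :=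
      Submodule.Quotient.subsingleton_iff.2 (Submodule.submoduleOf_eq_top.2 h)
    rw [Module.finrank_zero_of_subsingleton (M := W), Nat.le_zero, Module.finrank_zero_iff] at hle
    exact Submodule.submoduleOf_eq_top.1 (Submodule.Quotient.subsingleton_iff.1 hle)

theorem MatrixResolution.cyc_le_bdry_of_projectiveResolution {A : Type} [CommRing A] {m : Ideal A}
    (ρ : MatrixResolution A m) {M : Type} [AddCommGroup M] [Module A M]
    (P : ProjectiveResolution (ModuleCat.of A M)) (n : ℕ)
    (hP : ∀ i, n < i → Limits.IsZero (P.complex.X i)) :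
    ρ.cyc M (n + 1) ≤ ρ.bdry M (n + 1) := by
  obtain ⟨ε, -, hε, h0⟩ := exists_augmentation P
  have hproj : ∀ i, Module.Projective A (P.complex.X i) := fun i =>
    have := P.projective i
    ModuleCat.projective_of_module_projective _
  let Z (j : ℕ) : Submodule A (P.complex.X j) := LinearMap.range (P.complex.d (j + 1) j).hom
  have hZ : ∀ t j, j + t = n → ρ.cyc (Z j) t ≤ ρ.bdry (Z j) t := by
    intro t
    induction t with
    | zero =>
      intro j hj z _
      have : Subsingleton (Z j) := by
        refine ⟨?_⟩
        rintro ⟨_, x, rfl⟩ ⟨_, y, rfl⟩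
        have := ModuleCat.subsingleton_of_isZero (hP (j + 1) (by omega))
        rw [Subsingleton.elim x y]
      rw [Subsingleton.elim z 0]
      exact Submodule.zero_mem _
    | succ t ih =>
      intro j hj
      exact ρ.cyc_le_bdry_succ (N := Z (j + 1)) (F := P.complex.X (j + 1)) (f := (Z (j + 1)).subtype)
        (g := (P.complex.d (j + 1) j).hom.rangeRestrict) Subtype.val_injective
        (LinearMap.surjective_rangeRestrict _) (fun x => by
          refine (Subtype.ext_iff.trans (exact_d_d P j x)).trans ?_
          simp [Z]) t (ih (j + 1) (by omega))
  exact ρ.cyc_le_bdry_succ (N := Z 0) (F := P.complex.X 0) (f := (Z 0).subtype) (g := ε.hom)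
    Subtype.val_injective hε (fun x => (h0 x).trans (by simp [Z])) n (hZ n 0 (by omega))

theorem homogeneousComponent_mul_of_isHomogeneous {σ k : Type} [CommRing k] {b : ℕ}
    {x : MvPolynomial σ k} (hx : x.IsHomogeneous b) (f : MvPolynomial σ k) (c : ℕ) :
    homogeneousComponent c (f * x) = if b ≤ c then homogeneousComponent (c - b) f * x else 0 := by
  have hsum : f * x = ∑ a ∈ Finset.range (f.totalDegree + 1), homogeneousComponent a f * x := by
    rw [← Finset.sum_mul, sum_homogeneousComponent]
  have h : ∀ a, homogeneousComponent c (homogeneousComponent a f * x) =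
      if c = a + b then homogeneousComponent a f * x else 0 := fun a =>
    homogeneousComponent_of_mem ((homogeneousComponent_isHomogeneous a f).mul hx)
  rw [hsum, map_sum, Finset.sum_congr rfl fun a _ => h a]
  split_ifs with hbc
  · have hc : ∀ a, c = a + b ↔ a = c - b := fun a => by omega
    simp only [hc, Finset.sum_ite_eq', Finset.mem_range]
    split_ifs with hd
    · rfl
    · rw [homogeneousComponent_eq_zero _ _ (by omega), zero_mul]
  · exact Finset.sum_eq_zero fun a _ => if_neg (by omega)

theorem homogeneousComponent_homogeneousComponent {σ k : Type} [CommRing k] (d e : ℕ)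
    (f : MvPolynomial σ k) : homogeneousComponent d (homogeneousComponent e f) =
      if d = e then homogeneousComponent e f else 0 :=
  homogeneousComponent_of_mem (homogeneousComponent_isHomogeneous e f)

/-- A grading on a module over a polynomial ring, given by its projections. -/
structure Grading (σ k : Type) [CommRing k] (K : Type) [AddCommGroup K]
    [Module (MvPolynomial σ k) K] where
  proj : ℕ → K →+ K
  proj_proj : ∀ d e x, proj d (proj e x) = if d = e then proj e x else 0
  exists_sum : ∀ x, ∃ n, x = ∑ d ∈ Finset.range n, proj d x
  proj_smul : ∀ (f : MvPolynomial σ k) x e d, proj e x = x →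
    proj d (f • x) = if e ≤ d then homogeneousComponent (d - e) f • x else 0

namespace Grading

variable {σ k : Type} [CommRing k]

/-- A submodule stable under the projections inherits the grading. -/
def ofSubmodule {K : Type} [AddCommGroup K] [Module (MvPolynomial σ k) K] (G : Grading σ k K)
    (N : Submodule (MvPolynomial σ k) K) (hN : ∀ d, ∀ x ∈ N, G.proj d x ∈ N) :
    Grading σ k N where
  proj d :=
    { toFun := fun x => ⟨G.proj d x, hN d x x.2⟩
      map_zero' := Subtype.ext (map_zero _)
      map_add' := fun x y => Subtype.ext (map_add _ _ _) }
  proj_proj d e x := by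
    ext
    refine (G.proj_proj d e x).trans ?_
    split_ifs <;> rfl
  exists_sum x := by
    obtain ⟨n, hn⟩ := G.exists_sum x
    exact ⟨n, Subtype.ext (hn.trans (by simp))⟩
  proj_smul f x e d hx := by
    ext
    refine (G.proj_smul f x e d (congrArg Subtype.val hx)).trans ?_
    split_ifs <;> rfl

/-- The grading on the quotient of a polynomial ring by a homogeneous ideal. -/
noncomputable def quotient (J : Ideal (MvPolynomial σ k))
    (hJ : ∀ f ∈ J, ∀ d, homogeneousComponent d f ∈ J) : Grading σ k (MvPolynomial σ k ⧸ J) where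
  proj d := QuotientAddGroup.map _ _ (homogeneousComponent d).toAddMonoidHom fun f hf => hJ f hf d
  proj_proj d e x := by
    obtain ⟨x, rfl⟩ := Ideal.Quotient.mk_surjective x
    refine (congrArg (Ideal.Quotient.mk J)
      (homogeneousComponent_homogeneousComponent d e x)).trans ?_
    split_ifs <;> rfl
  exists_sum x := by
    obtain ⟨x, rfl⟩ := Ideal.Quotient.mk_surjective x
    refine ⟨x.totalDegree + 1, (congrArg (Ideal.Quotient.mk J)
      (sum_homogeneousComponent x).symm).trans ?_⟩
    rw [map_sum]
    rfl
  proj_smul f x e d hx := by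
    obtain ⟨x, rfl⟩ := Ideal.Quotient.mk_surjective x
    rw [← hx]
    refine (congrArg (Ideal.Quotient.mk J) (homogeneousComponent_mul_of_isHomogeneous
      (homogeneousComponent_isHomogeneous e x) f d)).trans ?_
    split_ifs <;> rfl

/-- The grading on a free module whose basis elements have the prescribed degrees. -/
noncomputable def pi {ι : Type} [Fintype ι] (w : ι → ℕ) : Grading σ k (ι → MvPolynomial σ k) where
  proj d :=
    { toFun := fun v i => if w i ≤ d then homogeneousComponent (d - w i) (v i) else 0
      map_zero' := by
        ext1 i
        simp
      map_add' := fun x y => by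
        ext1 i
        by_cases h : w i ≤ d <;> simp [h] }
  proj_proj d e x := by
    ext1 i
    simp only [AddMonoidHom.coe_mk, ZeroHom.coe_mk]
    by_cases hd : w i ≤ d <;> by_cases he : w i ≤ e
    · rw [if_pos hd, if_pos he, homogeneousComponent_homogeneousComponent]
      by_cases h : d = e
      · simp [h, he]
      · rw [if_neg h, if_neg (by omega)]
        rfl
    · rw [if_pos hd, if_neg he, map_zero]
      split_ifs <;> simp [he]
    · rw [if_neg hd, if_neg (by omega)]
      rfl
    · rw [if_neg hd]
      split_ifs <;> simp [he]
  exists_sum x := by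
    obtain ⟨n, hn⟩ : ∃ n, ∀ i, w i + (x i).totalDegree < n :=
      ⟨∑ i, (w i + (x i).totalDegree) + 1, fun i => Nat.lt_succ_of_le
        (Finset.single_le_sum (f := fun i => w i + (x i).totalDegree)
          (fun _ _ => Nat.zero_le _) (Finset.mem_univ i))⟩
    refine ⟨n, ?_⟩
    ext1 i
    have hi := hn i
    simp only [AddMonoidHom.coe_mk, ZeroHom.coe_mk, Finset.sum_apply]
    obtain ⟨N, rfl⟩ : ∃ N, n = w i + N := ⟨n - w i, by omega⟩
    rw [Finset.sum_range_add, Finset.sum_eq_zero fun d hd => if_neg (by simpa using hd), zero_add]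
    simp only [Nat.le_add_right, if_true, Nat.add_sub_cancel_left]
    rw [← Finset.sum_subset (Finset.range_subset_range.2 (by omega : (x i).totalDegree + 1 ≤ N)),
      sum_homogeneousComponent]
    intro d _ hd
    exact homogeneousComponent_eq_zero _ _ (by simpa using hd)
  proj_smul f x e d hx := by
    ext1 i
    have hi := congrFun hx i
    simp only [AddMonoidHom.coe_mk, ZeroHom.coe_mk] at hi ⊢
    by_cases he : w i ≤ e
    · rw [if_pos he] at hi
      have hh : (x i).IsHomogeneous (e - w i) := hi ▸ homogeneousComponent_isHomogeneous _ _
      rw [Pi.smul_apply, smul_eq_mul, homogeneousComponent_mul_of_isHomogeneous hh]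
      by_cases hed : e ≤ d
      · rw [if_pos (by omega), if_pos (by omega), if_pos hed,
          show d - w i - (e - w i) = d - e by omega]
        rfl
      · rw [if_neg hed]
        split_ifs <;> first | omega | rfl
    · rw [if_neg he] at hi
      split_ifs <;> simp [← hi]

theorem pi_proj_apply {ι : Type} [Fintype ι] (w : ι → ℕ) (d : ℕ) (v : ι → MvPolynomial σ k)
    (i : ι) : (pi w).proj d v i = if w i ≤ d then homogeneousComponent (d - w i) (v i) else 0 := rfl

variable {K : Type} [AddCommGroup K] [Module (MvPolynomial σ k) K] (G : Grading σ k K)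

theorem exists_minimal_generators [Module.Finite (MvPolynomial σ k) K] :
    ∃ t : Finset K, (∀ g ∈ t, ∃ e, G.proj e g = g) ∧
      Submodule.span (MvPolynomial σ k) (t : Set K) = ⊤ ∧
      ∀ g ∈ t, g ∉ Submodule.span (MvPolynomial σ k) ((t : Set K) \ {g}) := by
  classical
  let P : Set (Finset K) := {t | (∀ g ∈ t, ∃ e, G.proj e g = g) ∧
    Submodule.span (MvPolynomial σ k) (t : Set K) = ⊤}
  have hP : P.Nonempty := by
    obtain ⟨s, hs⟩ := Module.Finite.fg_top (R := MvPolynomial σ k) (M := K)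
    choose n hn using G.exists_sum
    refine ⟨s.biUnion fun x => (Finset.range (n x)).image fun d => G.proj d x, ?_, ?_⟩
    · simp only [Finset.mem_biUnion, Finset.mem_image]
      rintro _ ⟨x, _, d, _, rfl⟩
      exact ⟨d, by rw [G.proj_proj, if_pos rfl]⟩
    · rw [eq_top_iff, ← hs, Submodule.span_le]
      intro x hx
      rw [hn x]
      refine Submodule.sum_mem _ fun d hd => Submodule.subset_span ?_
      simp only [Finset.coe_biUnion, Set.mem_iUnion, Finset.coe_image]
      exact ⟨x, hx, d, hd, rfl⟩
  obtain ⟨t, ht, hmin⟩ := (measure Finset.card).wf.has_min P hP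
  refine ⟨t, ht.1, ht.2, fun g hg hspan => hmin (t.erase g) ⟨?_, ?_⟩ (Finset.card_erase_lt_of_mem hg)⟩
  · exact fun x hx => ht.1 x (Finset.mem_of_mem_erase hx)
  · rw [Finset.coe_erase, eq_top_iff, ← ht.2, Submodule.span_le]
    intro x hx
    by_cases hxg : x = g
    · rwa [hxg]
    · exact Submodule.subset_span ⟨hx, hxg⟩

end Grading

namespace Grading

theorem exists_minimal_cover {σ k : Type} [Field k] {K : Type} [AddCommGroup K]
    [Module (MvPolynomial σ k) K] (G : Grading σ k K) [Module.Finite (MvPolynomial σ k) K] :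
    ∃ (ι : Type) (_ : Fintype ι) (w : ι → ℕ)
      (π : (ι → MvPolynomial σ k) →ₗ[MvPolynomial σ k] K), Function.Surjective π ∧
      (∀ d v, π ((pi w).proj d v) = G.proj d (π v)) ∧
      ∀ v, π v = 0 → ∀ i, v i ∈ idealOfVars σ k := by
  classical
  obtain ⟨t, hhom, hspan, hmin⟩ := G.exists_minimal_generators
  choose w hw using fun g : t => hhom g g.2
  let π := Fintype.linearCombination (MvPolynomial σ k) (Subtype.val : t → K)
  have hproj : ∀ d v, π ((pi w).proj d v) = G.proj d (π v) := by
    intro d v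
    simp only [π, Fintype.linearCombination_apply, map_sum, G.proj_smul _ _ _ d (hw _),
      pi_proj_apply, ite_smul, zero_smul]
  refine ⟨t, inferInstance, w, π, ?_, hproj, ?_⟩
  · rw [← LinearMap.range_eq_top, Fintype.range_linearCombination, Subtype.range_coe]
    exact hspan
  · intro v hv i
    rw [mem_idealOfVars_iff, constantCoeff_eq]
    by_contra hc
    have h := hproj (w i) v
    rw [hv, map_zero, Fintype.linearCombination_apply,
      ← Finset.add_sum_erase _ _ (Finset.mem_univ i), pi_proj_apply, if_pos le_rfl, Nat.sub_self,
      homogeneousComponent_zero, add_eq_zero_iff_eq_neg] at h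
    refine hmin i i.2 ?_
    have hi : (C (coeff 0 (v i))⁻¹ : MvPolynomial σ k) •
        (C (coeff 0 (v i)) : MvPolynomial σ k) • (i : K) = i := by
      rw [smul_smul, ← C_mul, inv_mul_cancel₀ hc, C_1, one_smul]
    refine (congrArg (· ∈ Submodule.span (MvPolynomial σ k) ((t : Set K) \ {(i : K)})) hi).mp ?_
    rw [h]
    refine Submodule.smul_mem _ _ (Submodule.neg_mem _ (Submodule.sum_mem _ fun j hj =>
      Submodule.smul_mem _ _ (Submodule.subset_span ⟨j.2, ?_⟩)))
    exact fun hji => Finset.ne_of_mem_erase hj (Subtype.ext hji)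

end Grading

theorem mem_smul_top_of_forall_mem {A ι : Type} [CommRing A] [Fintype ι] (m : Ideal A) (v : ι → A)
    (hv : ∀ i, v i ∈ m) : v ∈ m • (⊤ : Submodule A (ι → A)) := by
  classical
  rw [pi_eq_sum_univ v]
  exact Submodule.sum_mem _ fun i _ => Submodule.smul_mem_smul (hv i) trivial

theorem exists_projectiveResolution_of_cyc_le_bdry {l : ℕ} {k : Type} [Field k]
    (ρ : MatrixResolution (MvPolynomial (Fin l) k) (idealOfVars (Fin l) k)) (n : ℕ) :
    ∀ (K : Type) [AddCommGroup K] [Module (MvPolynomial (Fin l) k) K]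
      [Module.Finite (MvPolynomial (Fin l) k) K] (_ : Grading (Fin l) k K),
      ρ.cyc K (n + 1) ≤ ρ.bdry K (n + 1) →
      ∃ P : ProjectiveResolution (ModuleCat.of (MvPolynomial (Fin l) k) K),
        ∀ i, n < i → Limits.IsZero (P.complex.X i) := by
  induction n with
  | zero =>
    intro K _ _ _ G hK
    obtain ⟨ι, _, w, π, hπ, hproj, hker⟩ := G.exists_minimal_cover
    let N := LinearMap.ker π
    have hf : Function.Injective N.subtype := Subtype.val_injective
    have hfg : Function.Exact N.subtype π := LinearMap.exact_subtype_ker_map π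
    have hN : (⊤ : Submodule (MvPolynomial (Fin l) k) N) ≤ idealOfVars (Fin l) k • ⊤ := by
      intro x _
      refine (ρ.mem_bdry_zero_iff fun _ => x).1
        (ρ.mem_bdry_of_comp_mem_bdry hf hπ hfg 0 hK (fun _ => x) ?_)
      exact (ρ.mem_bdry_zero_iff _).2 (mem_smul_top_of_forall_mem _ _ (hker x x.2))
    obtain ⟨r, hr, hrN⟩ := Submodule.exists_sub_one_mem_and_smul_eq_zero_of_fg_of_le_smul _ _
      (IsNoetherian.noetherian _) hN
    have hr0 : r ≠ 0 := by
      rintro rfl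
      simp [mem_idealOfVars_iff] at hr
    have hinj : Function.Injective π := by
      rw [← LinearMap.ker_eq_bot, eq_bot_iff]
      intro x hx
      exact (smul_eq_zero.1 (congrArg Subtype.val (hrN ⟨x, hx⟩ trivial))).resolve_left hr0
    have : Module.Projective (MvPolynomial (Fin l) k) K :=
      Module.Projective.of_equiv (LinearEquiv.ofBijective π ⟨hinj, hπ⟩)
    refine ⟨ProjectiveResolution.self _, fun i hi => ?_⟩
    exact HomologicalComplex.isZero_single_obj_X _ _ _ _ hi.ne'
  | succ n ih =>
    intro K _ _ _ G hK
    obtain ⟨ι, _, w, π, hπ, hproj, -⟩ := G.exists_minimal_cover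
    let N := LinearMap.ker π
    have hf : Function.Injective N.subtype := Subtype.val_injective
    have hfg : Function.Exact N.subtype π := LinearMap.exact_subtype_ker_map π
    refine exists_projectiveResolution_of_shortExact N.subtype π hf hπ hfg n
      (ih N ((Grading.pi w).ofSubmodule N fun d x hx => ?_)
        (ρ.cyc_le_bdry_of_succ hf hπ hfg n hK))
    rw [LinearMap.mem_ker, hproj, LinearMap.mem_ker.1 hx, map_zero]

theorem homogeneousComponent_mem_map_rat {l : ℕ} (I : Ideal (MvPolynomial (Fin l) ℤ))
    (hI : ∀ f ∈ I, ∀ d : ℕ, homogeneousComponent d f ∈ I) :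
    ∀ f ∈ I.map (map (Int.castRingHom ℚ)), ∀ d : ℕ,
      homogeneousComponent d f ∈ I.map (map (Int.castRingHom ℚ)) := by
  intro f hf d
  obtain ⟨N, hN, g, hg, h⟩ := exists_smul_eq_of_mem_map_rat I f hf
  have hd : map (Int.castRingHom ℚ) (homogeneousComponent d g) = N • homogeneousComponent d f := by
    rw [← map_zsmul, ← h]
    ext c
    simp only [coeff_map, coeff_homogeneousComponent]
    split_ifs <;> simp
  have hf' : homogeneousComponent d f =
      C (N : ℚ)⁻¹ * map (Int.castRingHom ℚ) (homogeneousComponent d g) := by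
    rw [hd, ← Int.cast_smul_eq_zsmul ℚ, C_mul', smul_smul,
      inv_mul_cancel₀ (Int.cast_ne_zero.2 hN), one_smul]
  rw [hf']
  exact Ideal.mul_mem_left _ _ (Ideal.mem_map_of_mem _ (hI g hg d))

/-- If `I` is a homogeneous ideal of `ℤ[x_1,…,x_l]` and `p` a prime that is a
non-zero divisor on `R/I`, then the Betti numbers of `(R/I) ⊗ ℚ` over `ℚ[x_1,…,x_l]`
are bounded by those of `(R/I) ⊗ 𝔽_p` over `𝔽_p[x_1,…,x_l]`; consequently the
projective dimension of `(R/I) ⊗ ℚ` is at most that of `(R/I) ⊗ 𝔽_p`.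
(Here `(R/I) ⊗ ℚ = ℚ[x]/Iℚ[x]` and `(R/I) ⊗ 𝔽_p = 𝔽_p[x]/I𝔽_p[x]`.) -/
theorem betti_le_and_projDim_le (l : ℕ) (I : Ideal (MvPolynomial (Fin l) ℤ))
    (hI : ∀ f ∈ I, ∀ d : ℕ, MvPolynomial.homogeneousComponent d f ∈ I)
    (p : ℕ) [Fact p.Prime]
    (hreg : ∀ f : MvPolynomial (Fin l) ℤ, (p : MvPolynomial (Fin l) ℤ) * f ∈ I → f ∈ I) :
    (∀ i : ℕ,
      betti ℚ l (ModuleCat.of (MvPolynomial (Fin l) ℚ)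
        (MvPolynomial (Fin l) ℚ ⧸ I.map (MvPolynomial.map (Int.castRingHom ℚ)))) i ≤
      betti (ZMod p) l (ModuleCat.of (MvPolynomial (Fin l) (ZMod p))
        (MvPolynomial (Fin l) (ZMod p) ⧸ I.map (MvPolynomial.map (Int.castRingHom (ZMod p))))) i) ∧
    projDim (ModuleCat.of (MvPolynomial (Fin l) ℚ)
        (MvPolynomial (Fin l) ℚ ⧸ I.map (MvPolynomial.map (Int.castRingHom ℚ)))) ≤
      projDim (ModuleCat.of (MvPolynomial (Fin l) (ZMod p))
        (MvPolynomial (Fin l) (ZMod p) ⧸ I.map (MvPolynomial.map (Int.castRingHom (ZMod p))))) := by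
  obtain ⟨ρ, ρ', h⟩ := exists_matrixResolution_betti_le I p hreg
  refine ⟨fun i => (h i).1, le_sInf ?_⟩
  rintro _ ⟨n, rfl, P, hP⟩
  have hcyc := (h (n + 1)).2 (ρ'.cyc_le_bdry_of_projectiveResolution P n hP)
  obtain ⟨Q, hQ⟩ := exists_projectiveResolution_of_cyc_le_bdry ρ n _
    (Grading.quotient _ (homogeneousComponent_mem_map_rat I hI)) hcyc
  exact sInf_le ⟨n, rfl, Q, hQ⟩

end HApaper
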